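/- For all λ ≥ 21, the number of primes in the interval (λ, 2λ] is at least 3λ/(5 ln λ). -/

import Mathlib

open Finset Chebyshev ArithmeticFunction

/-- The number of integers in `(n, 2n]` that are coprime to `P`. -/
def dyadicCoprimeCount (P n : ℕ) : ℕ := #{m ∈ Ioc n (2 * n) | Nat.gcd m P = 1}

/-- An integer form of the inequality `3 m / (5 log m) ≤ c`, with `log m` replaced by a
piecewise linear minorant. -/
def LogCheck (m c : ℕ) : Prop :=
  3000 * m * 2 ^ Nat.log2 m ≤ 5 * c * 693 * ((Nat.log2 m - 1) * 2 ^ Nat.log2 m + m)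

instance (m c : ℕ) : Decidable (LogCheck m c) := Nat.decLe _ _

/-- Starting from `c = dyadicCoprimeCount P (N - f)`, verify `LogCheck` for the `f` integers in
`[N - f, N)` and return `dyadicCoprimeCount P N`, or `0` if a verification fails. -/
def sieveRun (P N : ℕ) : ℕ → ℕ → ℕ
  | 0, c => c
  | _ + 1, 0 => 0
  | f + 1, c + 1 =>
    if LogCheck (N - (f + 1) + 1) (c + 1) then
      sieveRun P N f (c + 1 + (if Nat.gcd (2 * (N - (f + 1)) + 1) P = 1 then 1 else 0)
        - (if Nat.gcd (N - (f + 1) + 1) P = 1 then 1 else 0))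
    else 0

/-- Run `sieveRun` on the `b` consecutive blocks of length `s` that end at `N`. -/
def sieveBlocks (P N s : ℕ) : ℕ → ℕ → ℕ
  | 0, c => c
  | b + 1, c =>
    match sieveRun P (N - b * s) s c with
    | 0 => 0
    | c + 1 => sieveBlocks P N s b (c + 1)

theorem dyadicCoprimeCount_succ {P : ℕ} (hP : 2 ∣ P) (n : ℕ) :
    dyadicCoprimeCount P (n + 1) =
      dyadicCoprimeCount P n + (if Nat.gcd (2 * n + 1) P = 1 then 1 else 0)
        - (if Nat.gcd (n + 1) P = 1 then 1 else 0) := by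
  have h2 : ¬ Nat.gcd (2 * n + 2) P = 1 := by
    intro h
    have : 2 ∣ Nat.gcd (2 * n + 2) P := Nat.dvd_gcd ⟨n + 1, by ring⟩ hP
    omega
  have key : dyadicCoprimeCount P (n + 1) + (if Nat.gcd (n + 1) P = 1 then 1 else 0) =
      dyadicCoprimeCount P n + (if Nat.gcd (2 * n + 1) P = 1 then 1 else 0) := by
    simp only [dyadicCoprimeCount, card_filter]
    have e1 : ∑ i ∈ Ioc n (2 * n + 2), (if Nat.gcd i P = 1 then 1 else 0) =
        (if Nat.gcd (n + 1) P = 1 then 1 else 0) +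
        ∑ i ∈ Ioc (n + 1) (2 * (n + 1)), (if Nat.gcd i P = 1 then 1 else 0) := by
      rw [← Finset.insert_Ioc_add_one_left_eq_Ioc (by omega), sum_insert (by simp)]
      rfl
    have e2 : ∑ i ∈ Ioc n (2 * n + 2), (if Nat.gcd i P = 1 then 1 else 0) =
        ∑ i ∈ Ioc n (2 * n), (if Nat.gcd i P = 1 then 1 else 0) +
        (if Nat.gcd (2 * n + 1) P = 1 then 1 else 0) := by
      rw [sum_Ioc_succ_top (by omega), sum_Ioc_succ_top (by omega), if_neg h2, add_zero]
    omega
  omega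

theorem sieveRun_sound {P N : ℕ} (hP : 2 ∣ P) (f c : ℕ) (hf : f ≤ N)
    (hc : c = dyadicCoprimeCount P (N - f)) (hr : sieveRun P N f c ≠ 0) :
    sieveRun P N f c = dyadicCoprimeCount P N ∧
      ∀ n, N - f ≤ n → n < N → LogCheck (n + 1) (dyadicCoprimeCount P n) := by
  induction f generalizing c with
  | zero => exact ⟨by simpa [sieveRun] using hc, fun n _ _ => by omega⟩
  | succ f ih =>
    cases c with
    | zero => simp [sieveRun] at hr
    | succ c =>
      have hs := dyadicCoprimeCount_succ hP (N - (f + 1))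
      rw [← hc, show N - (f + 1) + 1 = N - f by omega] at hs
      by_cases h : LogCheck (N - (f + 1) + 1) (c + 1)
      · rw [sieveRun, if_pos h, show N - (f + 1) + 1 = N - f by omega] at hr ⊢
        obtain ⟨h1, h2⟩ := ih _ (by omega) hs.symm hr
        refine ⟨h1, fun n hn hnN => ?_⟩
        rcases Nat.eq_or_lt_of_le hn with rfl | hn
        · rwa [← hc]
        · exact h2 n (by omega) hnN
      · simp [sieveRun, h] at hr

theorem sieveBlocks_sound {P N s : ℕ} (hP : 2 ∣ P) (b c : ℕ) (hb : b * s ≤ N)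
    (hc : c = dyadicCoprimeCount P (N - b * s)) (hr : sieveBlocks P N s b c ≠ 0) :
    ∀ n, N - b * s ≤ n → n < N → LogCheck (n + 1) (dyadicCoprimeCount P n) := by
  induction b generalizing c with
  | zero => exact fun n _ _ => by omega
  | succ b ih =>
    rw [Nat.succ_mul] at hb hc ⊢
    rw [sieveBlocks] at hr
    cases hrun : sieveRun P (N - b * s) s c with
    | zero => simp [hrun] at hr
    | succ r =>
      simp only [hrun] at hr
      obtain ⟨h1, h2⟩ := sieveRun_sound hP s c (by omega)
        (by rw [hc, Nat.sub_sub]) (by omega : sieveRun P (N - b * s) s c ≠ 0)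
      intro n hn hnN
      rcases lt_or_ge n (N - b * s) with h | h
      · exact h2 n (by omega) h
      · exact ih (r + 1) (by omega) (hrun ▸ h1) hr n h hnN

theorem log_ge_of_log2 {m : ℕ} (hm : 2 ≤ m) :
    0.693 * (((Nat.log2 m - 1 : ℕ) : ℝ) + m / 2 ^ Nat.log2 m) ≤ Real.log m := by
  set k := Nat.log2 m with hk
  have hk1 : 1 ≤ k := (Nat.le_log2 (by omega)).2 (by omega)
  have hlo : (2 : ℝ) ^ k ≤ m := by exact_mod_cast Nat.log2_self_le (by omega)
  have hhi : (m : ℝ) ≤ 2 ^ (k + 1) := by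
    exact_mod_cast (Nat.lt_log2_self (n := m)).le
  have h2k : (0 : ℝ) < 2 ^ k := by positivity
  set t : ℝ := m / 2 ^ k - 1 with ht
  have ht0 : 0 ≤ t := by rw [ht, sub_nonneg, one_le_div h2k]; exact hlo
  have ht1 : t ≤ 1 := by
    rw [ht, sub_le_iff_le_add, div_le_iff₀ h2k]; rw [pow_succ] at hhi; linarith
  have hb : (2 : ℝ) ^ t ≤ 1 + t := by
    have := rpow_one_add_le_one_add_mul_self (s := 1) (by norm_num) ht0 ht1
    norm_num at this
    exact this
  have hl := Real.log_le_log (by positivity) hb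
  rw [Real.log_rpow (by norm_num)] at hl
  have hm' : (m : ℝ) = 2 ^ k * (1 + t) := by rw [ht]; field_simp; ring
  have hlog : Real.log m = k * Real.log 2 + Real.log (1 + t) := by
    rw [hm', Real.log_mul (by positivity) (by positivity), Real.log_pow]
  have h693 := Real.log_two_gt_d9
  have hk0 : (0 : ℝ) ≤ k := by positivity
  rw [Nat.cast_sub hk1, hlog, show (m : ℝ) / 2 ^ k = 1 + t by rw [ht]; ring]
  push_cast
  nlinarith [mul_nonneg (add_nonneg hk0 ht0) (sub_nonneg.2 h693.le)]

theorem LogCheck.le {m c : ℕ} (hm : 2 ≤ m) (h : LogCheck m c) :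
    3 * (m : ℝ) / (5 * Real.log m) ≤ c := by
  have h1 := log_ge_of_log2 hm
  have hlog : 0 < Real.log m := Real.log_pos (by exact_mod_cast hm)
  have h' : (3000 * m * 2 ^ Nat.log2 m : ℝ) ≤
      5 * c * 693 * ((Nat.log2 m - 1 : ℕ) * 2 ^ Nat.log2 m + m) := by exact_mod_cast h
  have h2k : (0 : ℝ) < 2 ^ Nat.log2 m := by positivity
  have h3 : 3 * (m : ℝ) ≤ 5 * c * (0.693 * ((Nat.log2 m - 1 : ℕ) + m / 2 ^ Nat.log2 m)) := by
    refine le_of_mul_le_mul_right ?_ h2k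
    have : ((Nat.log2 m - 1 : ℕ) + (m : ℝ) / 2 ^ Nat.log2 m) * 2 ^ Nat.log2 m =
      (Nat.log2 m - 1 : ℕ) * 2 ^ Nat.log2 m + m := by field_simp
    rw [mul_assoc (5 * (c : ℝ)), mul_assoc (0.693 : ℝ), this]
    linarith
  rw [div_le_iff₀ (by positivity)]
  nlinarith [mul_le_mul_of_nonneg_left h1 (by positivity : (0 : ℝ) ≤ 5 * c)]

theorem prime_of_gcd_eq_one {P B m : ℕ} (hP : ∀ q ≤ B, 2 ≤ q → Nat.gcd q P ≠ 1)
    (hm : 2 ≤ m) (hmB : m < (B + 1) ^ 2) (h : Nat.gcd m P = 1) : m.Prime := by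
  by_contra hp
  have hq := Nat.minFac_prime (n := m) (by omega)
  have hsq := Nat.minFac_sq_le_self (by omega) hp
  have hle : m.minFac ≤ B := by
    have := lt_of_pow_lt_pow_left₀ 2 (by omega) (hsq.trans_lt hmB)
    omega
  exact hP _ hle hq.two_le (Nat.Coprime.coprime_dvd_left (Nat.minFac_dvd m) h)

theorem card_primes_ge_of_sieve {P B N s b c : ℕ} (hP2 : 2 ∣ P)
    (hP : ∀ q ≤ B, 2 ≤ q → Nat.gcd q P ≠ 1) (hNB : 2 * N ≤ (B + 1) ^ 2) (hb : b * s < N)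
    (hc : dyadicCoprimeCount P (N - b * s) = c) (hr : sieveBlocks P N s b c ≠ 0) {n : ℕ}
    (hn : N - b * s ≤ n) (hnN : n < N) :
    3 * ((n + 1 : ℕ) : ℝ) / (5 * Real.log (n + 1 : ℕ)) ≤ #{p ∈ Ioc n (2 * n) | p.Prime} := by
  have h := sieveBlocks_sound hP2 b c hb.le hc.symm hr n hn hnN
  refine (h.le (by omega)).trans ?_
  norm_cast
  refine card_le_card fun m hm => ?_
  simp only [mem_filter, mem_Ioc] at hm ⊢
  exact ⟨hm.1, prime_of_gcd_eq_one hP (by omega) (by omega) hm.2⟩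

theorem card_primes_ge_of_lt {n : ℕ} (h1 : 21 ≤ n) (h2 : n < 16384) :
    3 * ((n + 1 : ℕ) : ℝ) / (5 * Real.log (n + 1 : ℕ)) ≤ #{p ∈ Ioc n (2 * n) | p.Prime} := by
  rcases lt_or_ge n 264 with h | h
  · exact card_primes_ge_of_sieve (P := 9699690) (B := 22) (N := 264) (s := 81) (b := 3) (c := 5)
      (by decide) (by decide +kernel) (by norm_num) (by norm_num) (by decide +kernel)
      (by decide +kernel) h1 h
  · exact card_primes_ge_of_sieve
      (P := 5397346292805549782720214077673687806275517530364350655459511599582614290)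
      (B := 181) (N := 16384) (s := 124) (b := 130) (c := 43)
      (by decide +kernel) (by decide +kernel) (by norm_num) (by norm_num) (by decide +kernel)
      (by decide +kernel) h h2

theorem log_factorial_eq_sum_vonMangoldt (N : ℕ) :
    Real.log N.factorial = ∑ m ∈ Ioc 0 N, vonMangoldt m * (N / m : ℕ) := by
  rw [← ArithmeticFunction.sum_Ioc_mul_zeta_eq_sum]
  simp only [vonMangoldt_mul_zeta, log_apply]
  induction N with
  | zero => simp
  | succ n ih =>
    rw [sum_Ioc_succ_top (Nat.zero_le _), ← ih, Nat.factorial_succ, Nat.cast_mul,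
      Real.log_mul (by positivity) (by positivity), add_comm]

theorem log_factorial_eq_sum_vonMangoldt_of_le {N M : ℕ} (h : N ≤ M) :
    Real.log N.factorial = ∑ m ∈ Ioc 0 M, vonMangoldt m * (N / m : ℕ) := by
  rw [log_factorial_eq_sum_vonMangoldt]
  refine sum_subset (Ioc_subset_Ioc_right h) fun m hm hm' => ?_
  simp only [mem_Ioc] at hm hm'
  rw [Nat.div_eq_of_lt (by omega)]
  simp

/-- The logarithm of Chebyshev's integer factorial ratio. -/
noncomputable def chebyshevRatioLog (N : ℕ) : ℝ :=
  Real.log N.factorial - Real.log (N / 2).factorial - Real.log (N / 3).factorial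
    - Real.log (N / 5).factorial + Real.log (N / 30).factorial

theorem chebyshevRatioLog_eq_sum (N : ℕ) :
    chebyshevRatioLog N = ∑ m ∈ Ioc 0 N, vonMangoldt m *
      ((N / m : ℕ) - (N / m / 2 : ℕ) - (N / m / 3 : ℕ) - (N / m / 5 : ℕ) + (N / m / 30 : ℕ)) := by
  rw [chebyshevRatioLog, log_factorial_eq_sum_vonMangoldt N,
    log_factorial_eq_sum_vonMangoldt_of_le (Nat.div_le_self N 2),
    log_factorial_eq_sum_vonMangoldt_of_le (Nat.div_le_self N 3),
    log_factorial_eq_sum_vonMangoldt_of_le (Nat.div_le_self N 5),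
    log_factorial_eq_sum_vonMangoldt_of_le (Nat.div_le_self N 30),
    ← sum_sub_distrib, ← sum_sub_distrib, ← sum_sub_distrib, ← sum_add_distrib]
  refine sum_congr rfl fun m _ => ?_
  simp only [Nat.div_div_eq_div_mul, mul_comm m]
  ring

theorem chebyshevRatioLog_le_psi (N : ℕ) : chebyshevRatioLog N ≤ psi N := by
  rw [chebyshevRatioLog_eq_sum, psi, Nat.floor_natCast]
  refine sum_le_sum fun m _ => mul_le_of_le_one_right vonMangoldt_nonneg ?_
  have h : N / m + N / m / 30 ≤ 1 + N / m / 2 + N / m / 3 + N / m / 5 := by omega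
  have : ((N / m : ℕ) : ℝ) + (N / m / 30 : ℕ) ≤
    1 + (N / m / 2 : ℕ) + (N / m / 3 : ℕ) + (N / m / 5 : ℕ) := by exact_mod_cast h
  linarith

theorem psi_sub_psi_div_six_le (N : ℕ) : psi N - psi (N / 6 : ℕ) ≤ chebyshevRatioLog N := by
  rw [chebyshevRatioLog_eq_sum, psi, psi, Nat.floor_natCast, Nat.floor_natCast,
    ← sum_Ioc_consecutive _ (Nat.zero_le (N / 6)) (Nat.div_le_self N 6), add_sub_cancel_left,
    ← sum_Ioc_consecutive _ (Nat.zero_le (N / 6)) (Nat.div_le_self N 6)]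
  refine le_add_of_nonneg_of_le (sum_nonneg fun m _ => ?_) (sum_le_sum fun m hm => ?_)
  · refine mul_nonneg vonMangoldt_nonneg ?_
    have h : N / m / 2 + N / m / 3 + N / m / 5 ≤ N / m + N / m / 30 := by omega
    have : ((N / m / 2 : ℕ) : ℝ) + (N / m / 3 : ℕ) + (N / m / 5 : ℕ) ≤
      (N / m : ℕ) + (N / m / 30 : ℕ) := by exact_mod_cast h
    linarith
  · rw [mem_Ioc] at hm
    have h1 : 1 ≤ N / m := (Nat.one_le_div_iff (by omega)).2 hm.2
    have h6 : N / m < 6 := (Nat.div_lt_iff_lt_mul (by omega)).2 (by omega)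
    refine le_mul_of_one_le_right vonMangoldt_nonneg ?_
    interval_cases N / m <;> norm_num

theorem log_factorial_le {N : ℕ} (hN : N ≠ 0) :
    Real.log N.factorial ≤ N * Real.log N - N + 1 + Real.log N := by
  induction N, Nat.one_le_iff_ne_zero.2 hN using Nat.le_induction with
  | base => simp
  | succ n hn ih =>
    have ih := ih (by omega)
    have hn0 : (0 : ℝ) < n := by exact_mod_cast hn
    rw [Nat.factorial_succ, Nat.cast_mul, Real.log_mul (by positivity) (by positivity)]
    have h1 := Real.log_le_sub_one_of_pos (show 0 < (n : ℝ) / (n + 1) by positivity)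
    rw [Real.log_div (by positivity) (by positivity)] at h1
    have h2 : (n + 1) * (Real.log n - Real.log (n + 1)) ≤ - 1 := by
      calc _ ≤ (n + 1) * ((n : ℝ) / (n + 1) - 1) := by gcongr
        _ = _ := by field_simp; ring
    push_cast
    nlinarith

theorem log_factorial_floor_le {u y : ℝ} (hu : 0 < u) (huy : u ≤ y) (hy : 1 ≤ y) :
    Real.log (⌊u⌋₊).factorial ≤ u * Real.log u - u + 1 + Real.log y := by
  have hly := Real.log_nonneg hy
  rcases lt_or_ge u 1 with h | h
  · rw [Nat.floor_eq_zero.2 h]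
    have h1 := Real.log_le_sub_one_of_pos (inv_pos.2 hu)
    rw [Real.log_inv] at h1
    have h2 : u * -Real.log u ≤ 1 - u := by
      calc _ ≤ u * (u⁻¹ - 1) := by gcongr
        _ = _ := by field_simp
    simp only [Nat.factorial_zero, Nat.cast_one, Real.log_one]
    linarith
  · have hN : ⌊u⌋₊ ≠ 0 := by rwa [Ne, Nat.floor_eq_zero, not_lt]
    have hNu : (⌊u⌋₊ : ℝ) ≤ u := Nat.floor_le hu.le
    set N := ⌊u⌋₊
    have hN1 : (1 : ℝ) ≤ N := by exact_mod_cast Nat.one_le_iff_ne_zero.2 hN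
    have hs := log_factorial_le hN
    have hlN := Real.log_nonneg hN1
    have hlNy := Real.log_le_log (by positivity) (hNu.trans huy)
    have h1 := Real.log_le_sub_one_of_pos (show 0 < N / u by positivity)
    rw [Real.log_div (by positivity) (by positivity)] at h1
    have h2 : u * (Real.log N - Real.log u) ≤ N - u := by
      calc _ ≤ u * (N / u - 1) := by gcongr
        _ = _ := by field_simp
    nlinarith

theorem le_log_factorial_floor {u y : ℝ} (hu : 0 < u) (huy : u ≤ y) (hy : 1 ≤ y) :
    u * Real.log u - u - Real.log y ≤ Real.log (⌊u⌋₊).factorial := by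
  have hly := Real.log_nonneg hy
  rcases lt_or_ge u 1 with h | h
  · rw [Nat.floor_eq_zero.2 h]
    have := Real.log_neg hu h
    simp only [Nat.factorial_zero, Nat.cast_one, Real.log_one]
    nlinarith
  · have hN : ⌊u⌋₊ ≠ 0 := by rwa [Ne, Nat.floor_eq_zero, not_lt]
    set N := ⌊u⌋₊
    have hN1 : (1 : ℝ) ≤ N := by exact_mod_cast Nat.one_le_iff_ne_zero.2 hN
    have hNu : (N : ℝ) ≤ u := Nat.floor_le hu.le
    have huN : u < N + 1 := Nat.lt_floor_add_one u
    have hs := Stirling.le_log_factorial_stirling hN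
    have h2pi : 0 ≤ Real.log (2 * Real.pi) := Real.log_nonneg (by nlinarith [Real.pi_gt_three])
    have hlN := Real.log_nonneg hN1
    have hlu := Real.log_le_log hu huy
    have hlu0 := Real.log_nonneg h
    have h1 := Real.log_le_sub_one_of_pos (show 0 < u / N by positivity)
    rw [Real.log_div (by positivity) (by positivity)] at h1
    have h2 : N * (Real.log u - Real.log N) ≤ u - N := by
      calc _ ≤ N * (u / N - 1) := by gcongr
        _ = _ := by field_simp
    nlinarith

/-- Chebyshev's constant `0.92129…`. -/
noncomputable def chebyshevConst : ℝ :=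
  Real.log 2 / 2 + Real.log 3 / 3 + Real.log 5 / 5 - Real.log 30 / 30

theorem log_thirty : Real.log 30 = Real.log 2 + Real.log 3 + Real.log 5 := by
  rw [← Real.log_mul (by norm_num) (by norm_num), ← Real.log_mul (by norm_num) (by norm_num)]
  norm_num

theorem chebyshevConst_gt : 0.9212 < chebyshevConst := by
  rw [chebyshevConst, log_thirty]
  linarith [Real.log_two_gt_d9, Real.log_three_gt_d9, Real.log_five_gt_d9]

theorem chebyshevConst_lt : chebyshevConst < 0.9213 := by
  rw [chebyshevConst, log_thirty]
  linarith [Real.log_two_lt_d9, Real.log_three_lt_d9, Real.log_five_lt_d9]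

theorem log_factorial_div_bounds {N k : ℕ} (hN : 1 ≤ N) (hk : 1 ≤ k) :
    (N : ℝ) / k * (Real.log N - Real.log k) - N / k - Real.log N ≤
        Real.log (N / k).factorial ∧
      Real.log (N / k).factorial ≤
        (N : ℝ) / k * (Real.log N - Real.log k) - N / k + 1 + Real.log N := by
  have hN' : (1 : ℝ) ≤ N := by exact_mod_cast hN
  have hk' : (1 : ℝ) ≤ k := by exact_mod_cast hk
  have hu : (0 : ℝ) < N / k := by positivity
  have huy : (N : ℝ) / k ≤ N := div_le_self (by positivity) hk'
  rw [← Real.log_div (by positivity) (by positivity), ← Nat.floor_div_eq_div (K := ℝ) N k]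
  exact ⟨le_log_factorial_floor hu huy hN', log_factorial_floor_le hu huy hN'⟩

theorem chebyshevRatioLog_bounds {N : ℕ} (hN : 1 ≤ N) :
    chebyshevConst * N - 3 - 5 * Real.log N ≤ chebyshevRatioLog N ∧
      chebyshevRatioLog N ≤ chebyshevConst * N + 2 + 5 * Real.log N := by
  have h1 := log_factorial_div_bounds hN le_rfl
  have h2 := log_factorial_div_bounds hN (show 1 ≤ 2 by norm_num)
  have h3 := log_factorial_div_bounds hN (show 1 ≤ 3 by norm_num)
  have h5 := log_factorial_div_bounds hN (show 1 ≤ 5 by norm_num)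
  have h30 := log_factorial_div_bounds hN (show 1 ≤ 30 by norm_num)
  simp only [Nat.cast_one, Nat.cast_ofNat, Nat.div_one, div_one, Real.log_one] at h1 h2 h3 h5 h30
  rw [chebyshevRatioLog, chebyshevConst]
  constructor <;> linarith

theorem log_le_mul_sqrt {x : ℝ} (hx : 0 < x) : Real.log x ≤ 0.736 * √x := by
  have hs : 0 < √x := Real.sqrt_pos.2 hx
  have h := Real.log_le_sub_one_of_pos (show 0 < √x / Real.exp 1 by positivity)
  rw [Real.log_div (by positivity) (by positivity), Real.log_exp, Real.log_sqrt hx.le] at h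
  have h2 : √x / Real.exp 1 ≤ 0.368 * √x := by
    rw [div_le_iff₀ (by positivity)]
    nlinarith [Real.exp_one_gt_d9]
  linarith

theorem psi_natCast_le (N : ℕ) : psi N ≤ 1.11 * N + 9.6 * √N := by
  induction N using Nat.strong_induction_on with
  | _ N ih =>
    rcases Nat.eq_zero_or_pos N with rfl | hN
    · simp
    have hN' : (1 : ℝ) ≤ N := by exact_mod_cast hN
    have h1 := psi_sub_psi_div_six_le N
    have h2 := (chebyshevRatioLog_bounds hN).2
    have h3 := ih (N / 6) (by omega)
    have h4 : ((N / 6 : ℕ) : ℝ) ≤ N / 6 := by exact_mod_cast Nat.cast_div_le (m := N) (n := 6)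
    have h5 : √((N / 6 : ℕ) : ℝ) ≤ 0.4083 * √N := by
      rw [Real.sqrt_le_left (by positivity), mul_pow, Real.sq_sqrt (by positivity)]
      linarith
    have h6 := log_le_mul_sqrt (show (0 : ℝ) < N by positivity)
    have h7 : 1 ≤ √(N : ℝ) := Real.one_le_sqrt.2 hN'
    have h8 := mul_le_mul_of_nonneg_right chebyshevConst_lt.le (show (0 : ℝ) ≤ N by positivity)
    linarith

theorem psi_le_linear_add_sqrt {x : ℝ} (hx : 0 ≤ x) : psi x ≤ 1.11 * x + 9.6 * √x := by
  rw [psi_eq_psi_coe_floor]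
  have h := Nat.floor_le hx
  refine (psi_natCast_le _).trans ?_
  gcongr

theorem psi_rpow_inv_le {w a : ℝ} (k : ℕ) (ha : 0 < a) (hw : (a ^ 2) ^ (k + 1) ≤ w) :
    psi (w ^ ((k + 1 : ℕ) : ℝ)⁻¹) ≤ (1.11 + 9.6 / a) * (w / (a ^ 2) ^ k) := by
  have hw0 : 0 ≤ w := le_trans (by positivity) hw
  set y := w ^ ((k + 1 : ℕ) : ℝ)⁻¹
  have hy0 : 0 ≤ y := by positivity
  have hyw : y ^ (k + 1) = w := Real.rpow_inv_natCast_pow hw0 (by omega)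
  have hay : a ^ 2 ≤ y := le_of_pow_le_pow_left₀ (by omega) hy0 (hyw ▸ hw)
  have has : a ≤ √y := Real.le_sqrt_of_sq_le hay
  have h1 : √y ≤ y / a := by
    rw [le_div_iff₀ ha]
    nlinarith [Real.mul_self_sqrt hy0, Real.sqrt_nonneg y]
  have h2 : y ≤ w / (a ^ 2) ^ k := by
    rw [le_div_iff₀ (by positivity), ← hyw, pow_succ y, mul_comm]
    gcongr
  calc psi y ≤ 1.11 * y + 9.6 * √y := psi_le_linear_add_sqrt hy0
    _ ≤ 1.11 * y + 9.6 * (y / a) := by gcongr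
    _ = (1.11 + 9.6 / a) * y := by ring
    _ ≤ _ := by gcongr

theorem psi_sub_theta_le_of_large {w : ℝ} (hw : 32768 ≤ w) : psi w - theta w ≤ 0.0142 * w := by
  have h2 := psi_rpow_inv_le (w := w) (a := 13.4) 1 (by norm_num) (le_trans (by norm_num) hw)
  have h3 := psi_rpow_inv_le (w := w) (a := 5.65) 2 (by norm_num) (le_trans (by norm_num) hw)
  have h5 := psi_rpow_inv_le (w := w) (a := 2.82) 4 (by norm_num) (le_trans (by norm_num) hw)
  have h := psi_sub_theta_le_psi_add_psi_add_psi w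
  norm_num at h2 h3 h5 h ⊢
  linarith

theorem theta_two_mul_sub_theta_ge {n : ℕ} (hn : 16384 ≤ n) :
    0.6429 * ((n : ℝ) + 1) ≤ theta (2 * n : ℕ) - theta n := by
  have hn' : (16384 : ℝ) ≤ n := by exact_mod_cast hn
  have hn0 : (0 : ℝ) < n := by linarith
  have h1 := chebyshevRatioLog_le_psi (2 * n)
  have h2 := (chebyshevRatioLog_bounds (show 1 ≤ 2 * n by omega)).1
  have h3 := psi_sub_psi_div_six_le n
  have h4 := (chebyshevRatioLog_bounds (show 1 ≤ n by omega)).2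
  have h5 : psi (n / 6 : ℕ) ≤ 1.11 * (n / 6) + 9.6 * √(n / 6) :=
    (psi_mono (by exact_mod_cast Nat.cast_div_le (m := n) (n := 6))).trans
      (psi_le_linear_add_sqrt (by positivity))
  have h6 : √((n : ℝ) / 6) ≤ 0.0032 * n := by
    rw [Real.sqrt_le_left (by positivity)]
    nlinarith
  have h7 := psi_sub_theta_le_of_large (w := (2 * n : ℕ)) (by push_cast; linarith)
  have h8 := theta_le_psi n
  have h9 : Real.log n ≤ n / 16384 + 14 * Real.log 2 - 1 := by
    have := Real.log_le_sub_one_of_pos (show 0 < (n : ℝ) / 2 ^ 14 by positivity)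
    rw [Real.log_div (by positivity) (by positivity), Real.log_pow] at this
    norm_num at this
    linarith
  have h10 : Real.log (2 * n : ℕ) = Real.log 2 + Real.log n := by
    rw [Nat.cast_mul, Real.log_mul (by norm_num) (by positivity), Nat.cast_ofNat]
  have h11 := mul_le_mul_of_nonneg_right chebyshevConst_gt.le hn0.le
  have h12 := Real.log_two_lt_d9
  rw [h10] at h2
  push_cast at h1 h2 h7 ⊢
  linarith

theorem theta_two_mul_sub_theta_le (n : ℕ) :
    theta (2 * n : ℕ) - theta n ≤ #{p ∈ Ioc n (2 * n) | p.Prime} * Real.log (2 * n : ℕ) := by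
  rw [theta, theta, Nat.floor_natCast, Nat.floor_natCast, sum_filter, sum_filter,
    ← sum_Ioc_consecutive _ (Nat.zero_le n) (by omega : n ≤ 2 * n), add_sub_cancel_left,
    ← sum_filter, ← nsmul_eq_mul]
  refine sum_le_card_nsmul _ _ _ fun p hp => ?_
  simp only [mem_filter, mem_Ioc] at hp
  exact Real.log_le_log (by exact_mod_cast hp.2.pos) (by exact_mod_cast hp.1.2)

theorem card_primes_ge_of_large {n : ℕ} (hn : 16384 ≤ n) :
    3 * ((n + 1 : ℕ) : ℝ) / (5 * Real.log (n + 1 : ℕ)) ≤ #{p ∈ Ioc n (2 * n) | p.Prime} := by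
  have hn0 : (0 : ℝ) < n := by exact_mod_cast (by omega : 0 < n)
  have h := (theta_two_mul_sub_theta_ge hn).trans (theta_two_mul_sub_theta_le n)
  set c : ℝ := ((#{p ∈ Ioc n (2 * n) | p.Prime} : ℕ) : ℝ)
  have hc : 0 ≤ c := by positivity
  have h1 : 14 * Real.log 2 ≤ Real.log (n + 1 : ℕ) := by
    rw [← Nat.cast_ofNat (n := 14), ← Real.log_pow]
    exact Real.log_le_log (by norm_num) (by exact_mod_cast (by omega : 2 ^ 14 ≤ n + 1))
  have h2 : Real.log (2 * n : ℕ) ≤ Real.log 2 + Real.log (n + 1 : ℕ) := by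
    rw [← Real.log_mul (by norm_num) (by positivity)]
    exact Real.log_le_log (by positivity) (by push_cast; linarith)
  have h3 : c * Real.log (2 * n : ℕ) ≤ c * (15 / 14 * Real.log (n + 1 : ℕ)) := by
    gcongr
    linarith
  have h4 : 0 < Real.log (n + 1 : ℕ) := by linarith [Real.log_two_gt_d9]
  rw [div_le_iff₀ (by positivity)]
  push_cast at *
  linarith

theorem primes_in_dyadic_interval (lam : ℝ) (hlam : 21 ≤ lam) :
    3 * lam / (5 * Real.log lam) ≤
      (({p : ℕ | Nat.Prime p ∧ lam < (p : ℝ) ∧ (p : ℝ) ≤ 2 * lam} : Set ℕ).ncard : ℝ) := by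
  set n := ⌊lam⌋₊
  have h0 : 0 ≤ lam := by linarith
  have hn21 : 21 ≤ n := Nat.le_floor (by exact_mod_cast hlam)
  have hnl : (n : ℝ) ≤ lam := Nat.floor_le h0
  have hln : lam < n + 1 := Nat.lt_floor_add_one lam
  have hcount : 3 * ((n + 1 : ℕ) : ℝ) / (5 * Real.log (n + 1 : ℕ)) ≤
      #{p ∈ Ioc n (2 * n) | p.Prime} :=
    (lt_or_ge n 16384).elim (card_primes_ge_of_lt hn21) card_primes_ge_of_large
  have hexp : Real.exp 1 ≤ lam := by linarith [Real.exp_one_lt_d9]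
  have hmono : Real.log (n + 1 : ℕ) / (n + 1 : ℕ) ≤ Real.log lam / lam := by
    push_cast
    exact Real.log_div_self_antitoneOn hexp (hexp.trans hln.le) hln.le
  have hloglam : 0 < Real.log lam := Real.log_pos (by linarith)
  have hlogn : 0 < Real.log (n + 1 : ℕ) :=
    Real.log_pos (by exact_mod_cast (by omega : 1 < n + 1))
  have hle : 3 * lam / (5 * Real.log lam) ≤
      3 * ((n + 1 : ℕ) : ℝ) / (5 * Real.log (n + 1 : ℕ)) := by
    rw [div_le_div_iff₀ (by positivity) (by linarith)] at hmono
    rw [div_le_div_iff₀ (by positivity) (by positivity)]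
    linarith
  refine hle.trans (hcount.trans ?_)
  rw [← Set.ncard_coe_finset]
  refine Nat.cast_le.2 (Set.ncard_le_ncard (fun p hp => ?_) ?_)
  · simp only [coe_filter, mem_Ioc, Set.mem_ofPred_eq] at hp ⊢
    refine ⟨hp.2, (Nat.floor_lt h0).1 hp.1.1, ?_⟩
    have : (p : ℝ) ≤ 2 * n := by exact_mod_cast hp.1.2
    linarith
  · exact (Set.finite_Iic ⌊2 * lam⌋₊).subset fun p hp => Nat.le_floor hp.2.2
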